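/- Let 2 < p < 3, m > 0, and 0 < ω < m·√((p-2)(4-p)). Then there exists α with (2-p)/(2(6-p)) < α < 1/6 such that m²/ω² ≥ K_p(α), where K_p(α) = p²(1-2α)²/(8(p-2)(1-6α)(1+2α(p-3))). -/

import Mathlib

/-- The function `K_p(α)` from the proof of Lemma A.1. -/
noncomputable def Kp (p α : ℝ) : ℝ :=
  p^2 * (1-2*α)^2 / (8*(p-2)*(1-6*α)*(1 + 2*α*(p-3)))

/-- The value of `Kp p` at the left endpoint of the admissible interval. -/
theorem Kp_left_endpoint {p : ℝ} (hp2 : 2 < p) (hp3 : p < 3) :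
    Kp p ((2-p)/(2*(6-p))) = 1 / ((p-2)*(4-p)) := by
  have h0 : p ≠ 0 := by linarith
  have h2 : p - 2 ≠ 0 := by linarith
  have h4 : 4 - p ≠ 0 := by linarith
  have h6 : 6 - p ≠ 0 := by linarith
  have e1 : 1 - 2*((2-p)/(2*(6-p))) = 4/(6-p) := by field_simp; ring
  have e2 : 1 - 6*((2-p)/(2*(6-p))) = 2*p/(6-p) := by field_simp; ring
  have e3 : 1 + 2*((2-p)/(2*(6-p)))*(p-3) = p*(4-p)/(6-p) := by field_simp; ring
  rw [Kp, e1, e2, e3]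
  field_simp
  norm_num

theorem continuousAt_Kp_left_endpoint {p : ℝ} (hp2 : 2 < p) (hp3 : p < 3) :
    ContinuousAt (Kp p) ((2-p)/(2*(6-p))) := by
  have h6 : 6 - p ≠ 0 := by linarith
  have e2 : 1 - 6*((2-p)/(2*(6-p))) = 2*p/(6-p) := by field_simp; ring
  have e3 : 1 + 2*((2-p)/(2*(6-p)))*(p-3) = p*(4-p)/(6-p) := by field_simp; ring
  unfold Kp
  refine ContinuousAt.div (by fun_prop) (by fun_prop) ?_
  rw [e2, e3]
  have : 0 < p - 2 := by linarith
  have : 0 < 4 - p := by linarith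
  have : 0 < 6 - p := by linarith
  have : 0 < p := by linarith
  positivity

theorem exists_alpha_Kp_le (p m ω : ℝ) (hp2 : 2 < p) (hp3 : p < 3)
    (hm : 0 < m) (hω0 : 0 < ω) (hω : ω < m * Real.sqrt ((p-2)*(4-p))) :
    ∃ α : ℝ, (2-p)/(2*(6-p)) < α ∧ α < 1/6 ∧ m^2/ω^2 ≥ Kp p α := by
  have hpos : 0 < (p-2)*(4-p) := mul_pos (by linarith) (by linarith)
  have hsq : ω^2 < m^2 * ((p-2)*(4-p)) := by
    have h := pow_lt_pow_left₀ hω hω0.le two_ne_zero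
    rwa [mul_pow, Real.sq_sqrt hpos.le] at h
  have hlt : Kp p ((2-p)/(2*(6-p))) < m^2/ω^2 := by
    rw [Kp_left_endpoint hp2 hp3, div_lt_div_iff₀ hpos (by positivity)]
    linarith
  have hend : (2-p)/(2*(6-p)) < 1/6 := by
    rw [div_lt_div_iff₀ (by linarith) (by norm_num)]
    linarith
  have hK := ((continuousAt_Kp_left_endpoint hp2 hp3).eventually_lt_const hlt).filter_mono
    (nhdsWithin_le_nhds (s := Set.Ioi ((2-p)/(2*(6-p)))))
  obtain ⟨α, hα, hIoo⟩ := (hK.and (Ioo_mem_nhdsGT hend)).exists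
  exact ⟨α, hIoo.1, hIoo.2, hα.le⟩
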